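/- arXiv:1912.09333 — 3 statements merged into one kernel-verified Lean document; each statement's English description precedes it below -/
import Mathlib

section
/- Let d ≥ 1, fix ε > 0, and let b ∈ BMO(ℝ^d). There exists a constant C = C(d, ε) such that for every n ∈ ℕ and every cube Q ⊂ ℝ^d (with side length ℓ(Q)), Σ_{k∈ℤ : 2^k ≤ ℓ(Q)} ∫_Q (ζ_k * |E_{k+1−n} b − E_{k−n} b|²)(x) dx ≤ C |Q| ‖b‖_{BMO}², where * denotes convolution on ℝ^d. In other words, the measures dν_n(x,t) = Σ_{k∈ℤ} (ζ_k * |E_{k+1−n}b − E_{k−n}b|²)(x) dx δ_{2^k}(t) are Carleson measures on ℝ^d × (0,∞) with norm at most C ‖b‖_{BMO}², uniformly in n. -/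
open MeasureTheory Filter
open scoped ENNReal Topology

noncomputable section

/-- The `q`-variation seminorm of the family `(a t)_{t > 0}`, valued in `ℝ≥0∞`. -/
def vqVar (q : ℝ) (a : ℝ → ℝ) : ℝ≥0∞ :=
  ⨆ (u : ℕ → ℝ) (_ : StrictMono u) (_ : 0 < u 0),
    (∑' k : ℕ, ENNReal.ofReal |a (u (k + 1)) - a (u k)| ^ q) ^ (1 / q)

/-- A convex body: a nonempty bounded open convex set. -/
def IsConvexBody {E : Type*} [NormedAddCommGroup E] [NormedSpace ℝ E] (G : Set E) : Prop :=
  Convex ℝ G ∧ IsOpen G ∧ Bornology.IsBounded G ∧ G.Nonempty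

/-- The dilate `G_t = {z | t⁻¹ • z ∈ G}`. -/
def dilate {E : Type*} [SMul ℝ E] (G : Set E) (t : ℝ) : Set E := {z | t⁻¹ • z ∈ G}

/-- The bilinear averaging operator over the dilates of `G ⊆ ℝ^d × ℝ^d`. -/
def biAvg (d : ℕ) (G : Set ((Fin d → ℝ) × (Fin d → ℝ)))
    (f1 f2 : (Fin d → ℝ) → ℝ) (t : ℝ) (x : Fin d → ℝ) : ℝ :=
  (volume (dilate G t)).toReal⁻¹ * ∫ y in dilate G t, f1 (x + y.1) * f2 (x + y.2)

/-- The dyadic cube of generation `j` (side `2^j`) containing `x`. -/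
def dyadicPiece (d : ℕ) (j : ℤ) (x : Fin d → ℝ) : Set (Fin d → ℝ) :=
  {y | ∀ i, ⌊(2:ℝ) ^ (-j) * y i⌋ = ⌊(2:ℝ) ^ (-j) * x i⌋}

/-- The dyadic conditional expectation `E_j f`. -/
def dyadicCE (d : ℕ) (j : ℤ) (f : (Fin d → ℝ) → ℝ) (x : Fin d → ℝ) : ℝ :=
  ((2:ℝ) ^ (j * (d:ℤ)))⁻¹ * ∫ y in dyadicPiece d j x, f y

/-- The dyadic cube of generation `j` with lower-left corner `2^j • m`. -/
def dyadicCube (d : ℕ) (j : ℤ) (m : Fin d → ℤ) : Set (Fin d → ℝ) :=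
  {y | ∀ i, (2:ℝ) ^ j * (m i) ≤ y i ∧ y i < (2:ℝ) ^ j * (m i + 1)}

/-- The (axis-parallel, half-open) cube with corner `a` and side `l`. -/
def cube (d : ℕ) (a : Fin d → ℝ) (l : ℝ) : Set (Fin d → ℝ) :=
  {y | ∀ i, a i ≤ y i ∧ y i < a i + l}

/-- The Euclidean norm on `ℝ^d`. -/
def euclNorm (d : ℕ) (x : Fin d → ℝ) : ℝ := Real.sqrt (∑ i, x i ^ 2)

/-- `ζ(x) = (1 + |x|)^{-d-ε}`. -/
def zeta (d : ℕ) (ε : ℝ) (x : Fin d → ℝ) : ℝ := (1 + euclNorm d x) ^ (-((d:ℝ) + ε))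

/-- `ζ_k(x) = 2^{-kd} ζ(2^{-k} x)`. -/
def zetak (d : ℕ) (ε : ℝ) (k : ℤ) (x : Fin d → ℝ) : ℝ :=
  (2:ℝ) ^ (-(k * (d:ℤ))) * zeta d ε ((2:ℝ) ^ (-k) • x)

/-- Convolution on `ℝ^d`: `(g ⋆ h)(x) = ∫ g(x-y) h(y) dy`. -/
def convWith (d : ℕ) (g h : (Fin d → ℝ) → ℝ) (x : Fin d → ℝ) : ℝ :=
  ∫ y, g (x - y) * h y

/-- The normalized square function of the increments of `A` over `N` generations of a
`ι`-branching tree, averaged over the descendants of a vertex. -/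
def treeSquare {V ι : Type*} [Fintype ι] (child : V → ι → V) (A : V → ℝ) : ℕ → V → ℝ
  | 0, _ => 0
  | N + 1, v => (Fintype.card ι : ℝ)⁻¹ *
      ∑ s, ((A (child v s) - A v) ^ 2 + treeSquare child A N (child v s))

/-- A vertex of a tree-indexed `BMO` function is close to its children. -/
lemma abs_child_sub_le {V ι : Type*} [Fintype ι] {child : V → ι → V} {A : V → ℝ}
    {G : V → ℝ → ℝ} {B : ℝ}
    (hG : ∀ v c, ∑ s, G (child v s) c = Fintype.card ι * G v c)
    (hAG : ∀ v c, |A v - c| ≤ G v c) (hB : ∀ v, G v (A v) ≤ B) (v : V) (s : ι) :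
    |A (child v s) - A v| ≤ Fintype.card ι * B :=
  calc |A (child v s) - A v| ≤ G (child v s) (A v) := hAG _ _
    _ ≤ ∑ s, G (child v s) (A v) :=
        Finset.single_le_sum (f := fun s => G (child v s) (A v))
          (fun i _ => (abs_nonneg _).trans (hAG _ _)) (Finset.mem_univ s)
    _ = Fintype.card ι * G v (A v) := hG _ _
    _ ≤ Fintype.card ι * B := by gcongr; exact hB v

/-- The `L²` John–Nirenberg inequality for the square function of a tree-indexed `BMO` function. -/
lemma treeSquare_le {V ι : Type*} [Fintype ι] [Nonempty ι] {child : V → ι → V} {A : V → ℝ}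
    {G : V → ℝ → ℝ} {B : ℝ}
    (hA : ∀ v, ∑ s, A (child v s) = Fintype.card ι * A v)
    (hG : ∀ v c, ∑ s, G (child v s) c = Fintype.card ι * G v c)
    (hAG : ∀ v c, |A v - c| ≤ G v c) (hB : ∀ v, G v (A v) ≤ B) (N : ℕ) (v : V) :
    treeSquare child A N v ≤ 2 * (2 + Fintype.card ι : ℝ) ^ 2 * B ^ 2 := by
  set n : ℝ := (Fintype.card ι : ℝ) with hn
  have hn0 : 0 < n := by rw [hn]; exact_mod_cast Fintype.card_pos
  have hB0 : 0 ≤ B := (abs_nonneg _).trans ((hAG v _).trans (hB v))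
  have key : ∀ N : ℕ, ∀ v c, |A v - c| ≤ 2 * B → treeSquare child A N v + (A v - c) ^ 2
      ≤ (2 + n) ^ 2 * B ^ 2 + (2 + n) ^ 2 * B * G v c := by
    intro N
    induction N with
    | zero =>
      intro v c h
      have h1 : (A v - c) ^ 2 ≤ (2 * B) ^ 2 := by
        rw [← sq_abs]; gcongr
      have h2 : 0 ≤ (2 + n) ^ 2 * B * G v c := by
        have := (abs_nonneg _).trans (hAG v c)
        positivity
      simp only [treeSquare]
      nlinarith [mul_nonneg (by positivity : 0 ≤ n ^ 2 + 4 * n) (sq_nonneg B)]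
    | succ N ih =>
      intro v c h
      have hS : ∀ v, treeSquare child A N v ≤ 2 * (2 + n) ^ 2 * B ^ 2 := by
        intro v
        have h1 := ih v (A v) (by simpa using hB0)
        have h2 : (2 + n) ^ 2 * B * G v (A v) ≤ (2 + n) ^ 2 * B * B := by
          gcongr; exact hB v
        simp only [sub_self] at h1
        nlinarith
      have hs : ∀ s, treeSquare child A N (child v s) + (A (child v s) - c) ^ 2
          ≤ (2 + n) ^ 2 * B ^ 2 + (2 + n) ^ 2 * B * G (child v s) c := by
        intro s
        by_cases hc : |A (child v s) - c| ≤ 2 * B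
        · exact ih _ _ hc
        · push Not at hc
          have h1 := abs_child_sub_le hG hAG hB v s
          have h2 : |A (child v s) - c| ≤ (2 + n) * B := by
            have := abs_sub_le (A (child v s)) (A v) c
            rw [← hn] at h1
            linarith
          have h3 : (A (child v s) - c) ^ 2 ≤ ((2 + n) * B) ^ 2 := by
            rw [← sq_abs]; gcongr
          have h4 : (2 + n) ^ 2 * B * (2 * B) ≤ (2 + n) ^ 2 * B * G (child v s) c := by
            gcongr
            exact hc.le.trans (hAG _ _)
          nlinarith [hS (child v s)]
      have hsum := Finset.sum_le_sum (fun s (_ : s ∈ Finset.univ) => hs s)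
      rw [Finset.sum_add_distrib, Finset.sum_add_distrib, Finset.sum_const, Finset.card_univ,
        nsmul_eq_mul, ← hn, ← Finset.mul_sum, hG] at hsum
      have hvar : ∑ s, (A (child v s) - c) ^ 2
          = ∑ s, (A (child v s) - A v) ^ 2 + n * (A v - c) ^ 2 := by
        have e : ∀ s, (A (child v s) - c) ^ 2 = (A (child v s) - A v) ^ 2
            + (2 * (A v - c) * A (child v s) + ((A v - c) ^ 2 - 2 * (A v - c) * A v)) := by
          intro s; ring
        simp only [e]
        rw [Finset.sum_add_distrib, Finset.sum_add_distrib, ← Finset.mul_sum, hA,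
          Finset.sum_const, Finset.card_univ, nsmul_eq_mul, ← hn]
        ring
      rw [hvar] at hsum
      simp only [treeSquare, ← hn]
      rw [Finset.sum_add_distrib]
      refine le_of_mul_le_mul_left ?_ hn0
      have e : n * (n⁻¹ * (∑ s, (A (child v s) - A v) ^ 2
          + ∑ s, treeSquare child A N (child v s)) + (A v - c) ^ 2)
          = ∑ s, (A (child v s) - A v) ^ 2
          + ∑ s, treeSquare child A N (child v s) + n * (A v - c) ^ 2 := by
        field_simp
      rw [e]
      linarith
  have h1 := key N v (A v) (by simpa using hB0)
  have h2 : (2 + n) ^ 2 * B * G v (A v) ≤ (2 + n) ^ 2 * B * B := by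
    gcongr; exact hB v
  simp only [sub_self] at h1
  nlinarith

lemma dyadicPiece_eq_dyadicCube (d : ℕ) (j : ℤ) (x : Fin d → ℝ) :
    dyadicPiece d j x = dyadicCube d j (fun i => ⌊(2:ℝ) ^ (-j) * x i⌋) := by
  ext y
  have h : (0:ℝ) < 2 ^ j := by positivity
  simp only [dyadicPiece, dyadicCube, Set.mem_ofPred_eq, Int.floor_eq_iff, zpow_neg,
    le_inv_mul_iff₀ h, inv_mul_lt_iff₀ h]

lemma mem_dyadicCube_iff {d : ℕ} {j : ℤ} {m : Fin d → ℤ} {x : Fin d → ℝ} :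
    x ∈ dyadicCube d j m ↔ (fun i => ⌊(2:ℝ) ^ (-j) * x i⌋) = m := by
  have h : (0:ℝ) < 2 ^ j := by positivity
  simp only [dyadicCube, Set.mem_ofPred_eq, funext_iff, Int.floor_eq_iff, zpow_neg,
    le_inv_mul_iff₀ h, inv_mul_lt_iff₀ h]

lemma dyadicCube_eq_cube (d : ℕ) (j : ℤ) (m : Fin d → ℤ) :
    dyadicCube d j m = cube d (fun i => (2:ℝ) ^ j * m i) (2 ^ j) := by
  ext y
  simp only [dyadicCube, cube, Set.mem_ofPred_eq, mul_add, mul_one]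

lemma cube_eq_pi (d : ℕ) (a : Fin d → ℝ) (l : ℝ) :
    cube d a l = Set.univ.pi (fun i => Set.Ico (a i) (a i + l)) := by
  ext y
  simp [cube, Set.mem_pi]

lemma measurableSet_cube (d : ℕ) (a : Fin d → ℝ) (l : ℝ) : MeasurableSet (cube d a l) := by
  rw [cube_eq_pi]
  exact MeasurableSet.univ_pi fun i => measurableSet_Ico

lemma measurableSet_dyadicCube (d : ℕ) (j : ℤ) (m : Fin d → ℤ) :
    MeasurableSet (dyadicCube d j m) := by
  rw [dyadicCube_eq_cube]
  exact measurableSet_cube _ _ _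

lemma volume_cube (d : ℕ) (a : Fin d → ℝ) {l : ℝ} (hl : 0 ≤ l) :
    volume (cube d a l) = ENNReal.ofReal (l ^ d) := by
  rw [cube_eq_pi, volume_pi_pi]
  simp [Real.volume_Ico, ENNReal.ofReal_pow hl]

lemma volume_dyadicCube (d : ℕ) (j : ℤ) (m : Fin d → ℤ) :
    volume (dyadicCube d j m) = ENNReal.ofReal (2 ^ (j * (d:ℤ))) := by
  rw [dyadicCube_eq_cube, volume_cube _ _ (by positivity), zpow_mul, zpow_natCast]

lemma pairwise_disjoint_dyadicCube (d : ℕ) (j : ℤ) :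
    Pairwise (Function.onFun Disjoint (dyadicCube d j)) := by
  intro m m' hmm
  refine Set.disjoint_left.2 fun x hx hx' => hmm ?_
  rw [mem_dyadicCube_iff] at hx hx'
  exact hx.symm.trans hx'

lemma iUnion_dyadicCube (d : ℕ) (j : ℤ) : ⋃ m, dyadicCube d j m = Set.univ :=
  Set.eq_univ_of_forall fun _ => Set.mem_iUnion.2 ⟨_, mem_dyadicCube_iff.2 rfl⟩

/-- The children of a dyadic cube `(j, m)`. -/
def dyadicChild (d : ℕ) (v : ℤ × (Fin d → ℤ)) (s : Fin d → Fin 2) : ℤ × (Fin d → ℤ) :=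
  (v.1 - 1, fun i => 2 * v.2 i + (s i : ℕ))

lemma dyadicChild_injective (d : ℕ) (v : ℤ × (Fin d → ℤ)) :
    Function.Injective fun s => (dyadicChild d v s).2 := by
  intro s s' h
  ext i
  have := congrFun h i
  simp only [dyadicChild] at this
  omega

lemma dyadicCube_eq_iUnion_child (d : ℕ) (v : ℤ × (Fin d → ℤ)) :
    dyadicCube d v.1 v.2 = ⋃ s, dyadicCube d (dyadicChild d v s).1 (dyadicChild d v s).2 := by
  obtain ⟨j, m⟩ := v
  have hfl : ∀ t : ℝ, ⌊(2:ℝ) ^ (-j) * t⌋ = ⌊(2:ℝ) ^ (-(j - 1)) * t⌋ / 2 := by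
    intro t
    have h : (2:ℝ) ^ (-(j - 1)) = 2 * 2 ^ (-j) := by
      rw [neg_sub, sub_eq_add_neg, zpow_add₀ two_ne_zero, zpow_one]
    rw [h, show (2:ℝ) ^ (-j) * t = (2 * 2 ^ (-j) * t) / (2:ℕ) by push_cast; ring]
    exact_mod_cast Int.floor_div_natCast (2 * 2 ^ (-j) * t) 2
  ext x
  simp only [Set.mem_iUnion, mem_dyadicCube_iff, dyadicChild, hfl, funext_iff]
  constructor
  · intro h
    refine ⟨fun i => ⟨(⌊(2:ℝ) ^ (-(j - 1)) * x i⌋ - 2 * m i).toNat, ?_⟩, fun i => ?_⟩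
    · have := h i; omega
    · have := h i
      simp only
      omega
  · rintro ⟨s, hs⟩ i
    have := hs i
    have := (s i).2
    omega

lemma pairwise_disjoint_dyadicChild (d : ℕ) (v : ℤ × (Fin d → ℤ)) :
    Pairwise (Function.onFun Disjoint
      fun s => dyadicCube d (dyadicChild d v s).1 (dyadicChild d v s).2) := by
  intro s s' hs
  exact pairwise_disjoint_dyadicCube d (v.1 - 1) ((dyadicChild_injective d v).ne hs)

/-- The average of `f` over the dyadic cube `v`. -/
def dyadicAvg (d : ℕ) (f : (Fin d → ℝ) → ℝ) (v : ℤ × (Fin d → ℤ)) : ℝ :=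
  ((2:ℝ) ^ (v.1 * (d:ℤ)))⁻¹ * ∫ y in dyadicCube d v.1 v.2, f y

lemma dyadicCE_eq (d : ℕ) (j : ℤ) (f : (Fin d → ℝ) → ℝ) {m : Fin d → ℤ} {x : Fin d → ℝ}
    (hx : x ∈ dyadicCube d j m) : dyadicCE d j f x = dyadicAvg d f (j, m) := by
  rw [mem_dyadicCube_iff] at hx
  simp only [dyadicCE, dyadicAvg, dyadicPiece_eq_dyadicCube, hx]

lemma measurable_dyadicCE (d : ℕ) (j : ℤ) (f : (Fin d → ℝ) → ℝ) :
    Measurable (dyadicCE d j f) := by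
  have h : dyadicCE d j f = (fun m => dyadicAvg d f (j, m)) ∘
      fun x i => ⌊(2:ℝ) ^ (-j) * x i⌋ := by
    ext x
    exact dyadicCE_eq d j f (mem_dyadicCube_iff.2 rfl)
  rw [h]
  refine (Measurable.of_discrete).comp ?_
  refine measurable_pi_lambda _ fun i => Int.measurable_floor.comp ?_
  fun_prop

lemma integrableOn_dyadicCube {d : ℕ} {f : (Fin d → ℝ) → ℝ} (hf : LocallyIntegrable f volume)
    (v : ℤ × (Fin d → ℤ)) : IntegrableOn f (dyadicCube d v.1 v.2) volume := by
  refine (hf.integrableOn_isCompact (isCompact_univ_pi fun i =>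
    isCompact_Icc (a := (2:ℝ) ^ v.1 * v.2 i) (b := (2:ℝ) ^ v.1 * (v.2 i + 1)))).mono_set ?_
  intro y hy i _
  exact ⟨(hy i).1, (hy i).2.le⟩

lemma sum_dyadicAvg_child {d : ℕ} {f : (Fin d → ℝ) → ℝ} (hf : LocallyIntegrable f volume)
    (v : ℤ × (Fin d → ℤ)) :
    ∑ s, dyadicAvg d f (dyadicChild d v s)
      = Fintype.card (Fin d → Fin 2) * dyadicAvg d f v := by
  simp only [dyadicAvg]
  rw [dyadicCube_eq_iUnion_child, integral_iUnion_fintype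
    (fun s => measurableSet_dyadicCube _ _ _) (pairwise_disjoint_dyadicChild d v)
    (fun s => integrableOn_dyadicCube hf _), ← mul_assoc, Finset.mul_sum]
  refine Finset.sum_congr rfl fun s _ => ?_
  congr 1
  simp only [dyadicChild, Fintype.card_pi, Fintype.card_fin, Finset.prod_const, Finset.card_univ]
  rw [sub_mul, one_mul, zpow_sub₀ two_ne_zero, zpow_natCast]
  push_cast
  field_simp

lemma abs_dyadicAvg_sub_le {d : ℕ} {f : (Fin d → ℝ) → ℝ} (hf : LocallyIntegrable f volume)
    (v : ℤ × (Fin d → ℤ)) (c : ℝ) :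
    |dyadicAvg d f v - c| ≤ dyadicAvg d (fun x => |f x - c|) v := by
  have hpos : (0:ℝ) < 2 ^ (v.1 * (d:ℤ)) := by positivity
  have hv : volume (dyadicCube d v.1 v.2) ≠ ∞ := by rw [volume_dyadicCube]; simp
  have h : dyadicAvg d f v - c = dyadicAvg d (fun x => f x - c) v := by
    simp only [dyadicAvg]
    rw [integral_sub (integrableOn_dyadicCube hf v) (integrableOn_const hv)]
    rw [setIntegral_const, measureReal_def, volume_dyadicCube, ENNReal.toReal_ofReal hpos.le,
      smul_eq_mul, mul_sub, inv_mul_cancel_left₀ hpos.ne']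
  rw [h]
  simp only [dyadicAvg]
  rw [abs_mul, abs_of_pos (inv_pos.2 hpos)]
  gcongr
  exact abs_integral_le_integral_abs

/-- The square function of the dyadic martingale increments, integrated over a dyadic cube. -/
lemma sum_lintegral_dyadicCE_sub_sq (d : ℕ) (f : (Fin d → ℝ) → ℝ) (N : ℕ) :
    ∀ v : ℤ × (Fin d → ℤ), ∑ t ∈ Finset.range N, ∫⁻ x in dyadicCube d v.1 v.2,
      ENNReal.ofReal ((dyadicCE d (v.1 - t) f x - dyadicCE d (v.1 - t - 1) f x) ^ 2)
      = ENNReal.ofReal (2 ^ (v.1 * (d:ℤ)) * treeSquare (dyadicChild d) (dyadicAvg d f) N v) := by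
  have hnn : ∀ N v, 0 ≤ treeSquare (dyadicChild d) (dyadicAvg d f) N v := by
    intro N
    induction N with
    | zero => intro v; exact le_rfl
    | succ N ih =>
      intro v
      exact mul_nonneg (by positivity)
        (Finset.sum_nonneg fun s _ => add_nonneg (sq_nonneg _) (ih _))
  induction N with
  | zero => intro v; simp [treeSquare]
  | succ N ih =>
    intro v
    have hsplit : ∀ F : (Fin d → ℝ) → ℝ≥0∞, ∫⁻ x in dyadicCube d v.1 v.2, F x
        = ∑ s, ∫⁻ x in dyadicCube d (dyadicChild d v s).1 (dyadicChild d v s).2, F x := by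
      intro F
      rw [dyadicCube_eq_iUnion_child, lintegral_iUnion (fun s => measurableSet_dyadicCube _ _ _)
        (pairwise_disjoint_dyadicChild d v), tsum_fintype]
    have h0 : ∀ s, ∫⁻ x in dyadicCube d (dyadicChild d v s).1 (dyadicChild d v s).2,
        ENNReal.ofReal ((dyadicCE d v.1 f x - dyadicCE d (v.1 - 1) f x) ^ 2)
        = ENNReal.ofReal (2 ^ ((v.1 - 1) * (d:ℤ)) *
          (dyadicAvg d f (dyadicChild d v s) - dyadicAvg d f v) ^ 2) := by
      intro s
      rw [setLIntegral_congr_fun (g := fun _ => ENNReal.ofReal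
        ((dyadicAvg d f (dyadicChild d v s) - dyadicAvg d f v) ^ 2))
        (measurableSet_dyadicCube _ _ _)]
      · rw [setLIntegral_const, volume_dyadicCube, mul_comm, ENNReal.ofReal_mul (by positivity)]
        rfl
      · intro x hx
        have hx' : x ∈ dyadicCube d v.1 v.2 := by
          rw [dyadicCube_eq_iUnion_child]; exact Set.mem_iUnion.2 ⟨s, hx⟩
        simp only
        rw [dyadicCE_eq d v.1 f hx', dyadicCE_eq d (v.1 - 1) f hx, ← sq_abs, abs_sub_comm, sq_abs]
        rfl
    rw [Finset.sum_range_succ']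
    simp only [hsplit]
    rw [Finset.sum_comm, ← Finset.sum_add_distrib]
    have h1 : ∀ s, (∑ t ∈ Finset.range N,
        ∫⁻ x in dyadicCube d (dyadicChild d v s).1 (dyadicChild d v s).2,
          ENNReal.ofReal ((dyadicCE d (v.1 - ((t + 1 : ℕ) : ℤ)) f x
            - dyadicCE d (v.1 - ((t + 1 : ℕ) : ℤ) - 1) f x) ^ 2))
        = ENNReal.ofReal (2 ^ ((v.1 - 1) * (d:ℤ)) *
          treeSquare (dyadicChild d) (dyadicAvg d f) N (dyadicChild d v s)) := by
      intro s
      rw [show (2:ℝ) ^ ((v.1 - 1) * (d:ℤ)) = 2 ^ ((dyadicChild d v s).1 * (d:ℤ)) from rfl, ← ih]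
      refine Finset.sum_congr rfl fun t _ => ?_
      rw [show v.1 - ((t + 1 : ℕ) : ℤ) = (dyadicChild d v s).1 - t by
        simp only [dyadicChild]; push_cast; ring]
    have h2 : ∀ s ∈ Finset.univ, (∑ t ∈ Finset.range N,
        ∫⁻ x in dyadicCube d (dyadicChild d v s).1 (dyadicChild d v s).2,
          ENNReal.ofReal ((dyadicCE d (v.1 - ((t + 1 : ℕ) : ℤ)) f x
            - dyadicCE d (v.1 - ((t + 1 : ℕ) : ℤ) - 1) f x) ^ 2))
        + ∫⁻ x in dyadicCube d (dyadicChild d v s).1 (dyadicChild d v s).2,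
          ENNReal.ofReal ((dyadicCE d (v.1 - ((0 : ℕ) : ℤ)) f x
            - dyadicCE d (v.1 - ((0 : ℕ) : ℤ) - 1) f x) ^ 2)
        = ENNReal.ofReal (2 ^ ((v.1 - 1) * (d:ℤ)) *
          (treeSquare (dyadicChild d) (dyadicAvg d f) N (dyadicChild d v s)
            + (dyadicAvg d f (dyadicChild d v s) - dyadicAvg d f v) ^ 2)) := by
      intro s _
      rw [h1 s, Nat.cast_zero, sub_zero, h0 s, ← ENNReal.ofReal_add
        (mul_nonneg (by positivity) (hnn _ _)) (by positivity), ← mul_add]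
    rw [Finset.sum_congr rfl h2, ← ENNReal.ofReal_sum_of_nonneg
      fun s _ => mul_nonneg (by positivity) (add_nonneg (hnn _ _) (sq_nonneg _)), ← Finset.mul_sum]
    congr 1
    simp only [treeSquare, Fintype.card_pi, Fintype.card_fin, Finset.prod_const, Finset.card_univ]
    rw [sub_mul, one_mul, zpow_sub₀ two_ne_zero, zpow_natCast, ← mul_assoc]
    push_cast
    simp only [add_comm, div_eq_mul_inv]

/-- The dyadic Carleson estimate for a `BMO` function. -/
lemma tsum_lintegral_dyadicCE_sub_sq_le {d : ℕ} {b : (Fin d → ℝ) → ℝ}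
    (hb : LocallyIntegrable b volume) {B : ℝ}
    (hB : ∀ (a : Fin d → ℝ) (l : ℝ), 0 < l →
      ∫ x in cube d a l, |b x - (l ^ d)⁻¹ * ∫ y in cube d a l, b y| ≤ B * l ^ d)
    (j : ℤ) (m : Fin d → ℤ) :
    ∑' t : ℕ, ∫⁻ x in dyadicCube d j m,
      ENNReal.ofReal ((dyadicCE d (j - t) b x - dyadicCE d (j - t - 1) b x) ^ 2)
      ≤ ENNReal.ofReal (2 ^ (j * (d:ℤ)) * (2 * (2 + 2 ^ d) ^ 2 * B ^ 2)) := by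
  rw [ENNReal.tsum_eq_iSup_nat]
  refine iSup_le fun N => ?_
  rw [sum_lintegral_dyadicCE_sub_sq d b N (j, m)]
  refine ENNReal.ofReal_le_ofReal (mul_le_mul_of_nonneg_left ?_ (by positivity))
  have h := treeSquare_le (child := dyadicChild d) (A := dyadicAvg d b)
    (G := fun v c => dyadicAvg d (fun x => |b x - c|) v) (B := B)
    (sum_dyadicAvg_child hb)
    (fun v c => sum_dyadicAvg_child (fun x => by
      obtain ⟨s, hs, hi⟩ := (hb.sub (locallyIntegrable_const c)) x
      exact ⟨s, hs, hi.abs⟩) v)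
    (abs_dyadicAvg_sub_le hb) ?_ N (j, m)
  · simpa using h
  · intro v
    have h := hB (fun i => (2:ℝ) ^ v.1 * v.2 i) (2 ^ v.1) (by positivity)
    rw [← dyadicCube_eq_cube, ← zpow_natCast, ← zpow_mul] at h
    simp only [dyadicAvg]
    rw [inv_mul_le_iff₀ (by positivity), mul_comm _ B]
    exact h

/-- The polynomially decaying weight `(1 + ‖y - a‖ / l) ^ (-p)`, for the sup norm. -/
def cubeWeight (d : ℕ) (p : ℝ) (a : Fin d → ℝ) (l : ℝ) (y : Fin d → ℝ) : ℝ :=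
  (1 + ‖y - a‖ / l) ^ (-p)

lemma cubeWeight_nonneg (d : ℕ) (p : ℝ) (a : Fin d → ℝ) {l : ℝ} (hl : 0 < l) (y : Fin d → ℝ) :
    0 ≤ cubeWeight d p a l y := by
  unfold cubeWeight; positivity

lemma measurable_cubeWeight (d : ℕ) (p : ℝ) (a : Fin d → ℝ) (l : ℝ) :
    Measurable (cubeWeight d p a l) := by
  unfold cubeWeight; fun_prop

lemma lintegral_cubeWeight (d : ℕ) (p : ℝ) (a : Fin d → ℝ) {l : ℝ} (hl : 0 < l) :
    ∫⁻ y, ENNReal.ofReal (cubeWeight d p a l y)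
      = ENNReal.ofReal (l ^ d) * ∫⁻ x : Fin d → ℝ, ENNReal.ofReal ((1 + ‖x‖) ^ (-p)) := by
  have hm : Measurable fun x : Fin d → ℝ => ENNReal.ofReal ((1 + ‖x‖) ^ (-p)) := by fun_prop
  have h1 : ∀ y, cubeWeight d p a l y = (1 + ‖l⁻¹ • (y - a)‖) ^ (-p) := by
    intro y
    rw [cubeWeight, norm_smul, Real.norm_of_nonneg (inv_nonneg.2 hl.le), div_eq_inv_mul]
  simp only [h1]
  rw [lintegral_sub_right_eq_self (fun y => ENNReal.ofReal ((1 + ‖l⁻¹ • y‖) ^ (-p))) a]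
  have h2 := Measure.map_addHaar_smul (volume : Measure (Fin d → ℝ)) (inv_ne_zero hl.ne')
  rw [Module.finrank_fin_fun, inv_pow, inv_inv, abs_of_pos (by positivity)] at h2
  have h3 := lintegral_map (μ := volume) hm (measurable_const_smul (α := Fin d → ℝ) l⁻¹)
  rw [h2, lintegral_smul_measure] at h3
  exact h3.symm

lemma cubeWeight_le_of_norm_sub_le {d : ℕ} {p : ℝ} (hp : 0 ≤ p) (a : Fin d → ℝ) {l : ℝ}
    (hl : 0 < l) {y z : Fin d → ℝ} (h : ‖y - z‖ ≤ 2 * l) :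
    cubeWeight d p a l y ≤ 3 ^ p * cubeWeight d p a l z := by
  have h1 : (1 + ‖z - a‖ / l) / 3 ≤ 1 + ‖y - a‖ / l := by
    have h2 : ‖z - a‖ ≤ ‖y - a‖ + ‖y - z‖ := by
      rw [norm_sub_rev y z]
      calc ‖z - a‖ = ‖(y - a) + (z - y)‖ := by congr 1; abel
        _ ≤ _ := norm_add_le _ _
    have h3 : ‖z - a‖ / l ≤ ‖y - a‖ / l + 2 := by
      rw [div_add' _ _ _ hl.ne']; gcongr; linarith
    have h4 : 0 ≤ ‖y - a‖ / l := by positivity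
    linarith
  calc cubeWeight d p a l y ≤ ((1 + ‖z - a‖ / l) / 3) ^ (-p) :=
        Real.rpow_le_rpow_of_nonpos (by positivity) h1 (by linarith)
    _ = 3 ^ p * cubeWeight d p a l z := by
        rw [Real.div_rpow (by positivity) (by norm_num), Real.rpow_neg (by norm_num : (0:ℝ) ≤ 3),
          div_inv_eq_mul, mul_comm, cubeWeight]

lemma norm_le_euclNorm (d : ℕ) (x : Fin d → ℝ) : ‖x‖ ≤ euclNorm d x := by
  refine (pi_norm_le_iff_of_nonneg (Real.sqrt_nonneg _)).2 fun i => ?_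
  refine Real.abs_le_sqrt ?_
  exact Finset.single_le_sum (f := fun i => x i ^ 2) (fun i _ => sq_nonneg _) (Finset.mem_univ i)

lemma measurable_zetak (d : ℕ) (ε : ℝ) (k : ℤ) : Measurable (zetak d ε k) := by
  unfold zetak zeta euclNorm; fun_prop

lemma zetak_nonneg (d : ℕ) (ε : ℝ) (k : ℤ) (x : Fin d → ℝ) : 0 ≤ zetak d ε k x := by
  have : 0 ≤ euclNorm d ((2:ℝ) ^ (-k) • x) := Real.sqrt_nonneg _
  unfold zetak zeta; positivity

lemma zetak_sub_le (d : ℕ) {ε : ℝ} (hε : 0 < ε) (k : ℤ) (x y : Fin d → ℝ) :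
    zetak d ε k (x - y) ≤ (((2:ℝ) ^ k) ^ d)⁻¹ * cubeWeight d (d + ε) y (2 ^ k) x := by
  unfold zetak zeta cubeWeight
  rw [zpow_neg, zpow_mul, zpow_natCast]
  have hp : 0 < d + ε := by positivity
  refine mul_le_mul_of_nonneg_left ?_ (by positivity)
  refine Real.rpow_le_rpow_of_nonpos (by positivity) ?_ (by linarith)
  gcongr
  refine le_trans (le_of_eq ?_) (norm_le_euclNorm _ _)
  rw [norm_smul, Real.norm_of_nonneg (by positivity), zpow_neg, div_eq_inv_mul]

lemma norm_sub_le_of_mem_cube {d : ℕ} {a x : Fin d → ℝ} {l : ℝ} (hl : 0 ≤ l)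
    (hx : x ∈ cube d a l) : ‖x - a‖ ≤ l := by
  refine (pi_norm_le_iff_of_nonneg hl).2 fun i => ?_
  have := hx i
  rw [Pi.sub_apply, Real.norm_of_nonneg (by linarith)]
  linarith

/-- The mass that `ζ_k` centred at `y` puts on a cube of side `l ≥ 2^k`. -/
lemma setLIntegral_zetak_le (d : ℕ) {ε : ℝ} (hε : 0 < ε) {I : ℝ}
    (hI : ∫⁻ x : Fin d → ℝ, ENNReal.ofReal ((1 + ‖x‖) ^ (-(d + ε))) ≤ ENNReal.ofReal I)
    (hI0 : 0 ≤ I) {k : ℤ} {l : ℝ} (hl : 0 < l) (hk : (2:ℝ) ^ k ≤ l) (a y : Fin d → ℝ) :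
    ∫⁻ x in cube d a l, ENNReal.ofReal (zetak d ε k (x - y))
      ≤ ENNReal.ofReal ((I * 3 ^ (d + ε) + 4 ^ (d + ε)) * cubeWeight d (d + ε) a l y) := by
  have hp : 0 < d + ε := by positivity
  set p : ℝ := d + ε with hpdef
  have h2k : (0:ℝ) < 2 ^ k := by positivity
  have hW := cubeWeight_nonneg d p a hl y
  rcases le_total ‖y - a‖ (2 * l) with hy | hy
  · calc ∫⁻ x in cube d a l, ENNReal.ofReal (zetak d ε k (x - y))
        ≤ ∫⁻ x, ENNReal.ofReal ((((2:ℝ) ^ k) ^ d)⁻¹) * ENNReal.ofReal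
            (cubeWeight d p y (2 ^ k) x) := by
          refine (setLIntegral_le_lintegral _ _).trans (lintegral_mono fun x => ?_)
          rw [← ENNReal.ofReal_mul (by positivity)]
          exact ENNReal.ofReal_le_ofReal (zetak_sub_le d hε k x y)
      _ = ∫⁻ x : Fin d → ℝ, ENNReal.ofReal ((1 + ‖x‖) ^ (-p)) := by
          rw [lintegral_const_mul _ (measurable_cubeWeight _ _ _ _).ennreal_ofReal,
            lintegral_cubeWeight _ _ _ h2k, ← mul_assoc, ← ENNReal.ofReal_mul (by positivity),
            inv_mul_cancel₀ (by positivity), ENNReal.ofReal_one, one_mul]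
      _ ≤ ENNReal.ofReal I := hI
      _ ≤ _ := by
          refine ENNReal.ofReal_le_ofReal ?_
          have h1 : cubeWeight d p a l a ≤ 3 ^ p * cubeWeight d p a l y :=
            cubeWeight_le_of_norm_sub_le hp.le a hl (by rwa [norm_sub_rev])
          have h2 : cubeWeight d p a l a = 1 := by simp [cubeWeight]
          rw [h2] at h1
          have h3 : 0 ≤ (4:ℝ) ^ p * cubeWeight d p a l y := by positivity
          nlinarith
  · have hbd : ∀ x ∈ cube d a l, zetak d ε k (x - y)
        ≤ (l ^ d)⁻¹ * (4 ^ p * cubeWeight d p a l y) := by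
      intro x hx
      have hxa := norm_sub_le_of_mem_cube hl.le hx
      have hxy : ‖y - a‖ / 2 ≤ ‖x - y‖ := by
        have : ‖y - a‖ ≤ ‖x - a‖ + ‖x - y‖ := by
          calc ‖y - a‖ = ‖(x - a) - (x - y)‖ := by congr 1; abel
            _ ≤ _ := norm_sub_le _ _
        linarith
      have hs : 1 ≤ l / 2 ^ k := by rwa [one_le_div h2k]
      have hu : l / 2 ^ k * ((1 + ‖y - a‖ / l) / 4) ≤ 1 + ‖x - y‖ / 2 ^ k := by
        have e : l / 2 ^ k * ((1 + ‖y - a‖ / l) / 4) = (l + ‖y - a‖) / 4 / 2 ^ k := by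
          field_simp
        rw [e]
        have : (l + ‖y - a‖) / 4 / 2 ^ k ≤ ‖x - y‖ / 2 ^ k := by gcongr; linarith
        linarith
      have hsp : (l / 2 ^ k) ^ (-p) ≤ ((l / 2 ^ k) ^ d)⁻¹ := by
        rw [← Real.rpow_natCast, ← Real.rpow_neg (by positivity)]
        exact Real.rpow_le_rpow_of_exponent_le hs (by linarith)
      calc zetak d ε k (x - y) ≤ _ := zetak_sub_le d hε k x y
        _ ≤ (((2:ℝ) ^ k) ^ d)⁻¹ * (l / 2 ^ k * ((1 + ‖y - a‖ / l) / 4)) ^ (-p) := by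
            unfold cubeWeight
            exact mul_le_mul_of_nonneg_left
              (Real.rpow_le_rpow_of_nonpos (by positivity) hu (by linarith)) (by positivity)
        _ = (((2:ℝ) ^ k) ^ d)⁻¹ * ((l / 2 ^ k) ^ (-p) * (4 ^ p * cubeWeight d p a l y)) := by
            rw [Real.mul_rpow (by positivity) (by positivity),
              Real.div_rpow (x := 1 + ‖y - a‖ / l) (by positivity) (by norm_num),
              Real.rpow_neg (by norm_num : (0:ℝ) ≤ 4), div_inv_eq_mul, cubeWeight,
              mul_comm ((4:ℝ) ^ p)]
        _ ≤ (((2:ℝ) ^ k) ^ d)⁻¹ * (((l / 2 ^ k) ^ d)⁻¹ * (4 ^ p * cubeWeight d p a l y)) := by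
            gcongr
        _ = _ := by
            rw [div_pow]; field_simp
    calc ∫⁻ x in cube d a l, ENNReal.ofReal (zetak d ε k (x - y))
        ≤ ∫⁻ x in cube d a l, ENNReal.ofReal ((l ^ d)⁻¹ * (4 ^ p * cubeWeight d p a l y)) :=
          setLIntegral_mono measurable_const fun x hx => ENNReal.ofReal_le_ofReal (hbd x hx)
      _ = ENNReal.ofReal (4 ^ p * cubeWeight d p a l y) := by
          rw [setLIntegral_const, volume_cube _ _ hl.le, ← ENNReal.ofReal_mul (by positivity)]
          congr 1
          field_simp
      _ ≤ _ := by
          refine ENNReal.ofReal_le_ofReal ?_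
          have : 0 ≤ I * 3 ^ p * cubeWeight d p a l y := by positivity
          linarith

lemma ofReal_convWith_le {d : ℕ} {g h : (Fin d → ℝ) → ℝ} (hg : ∀ x, 0 ≤ g x) (hh : ∀ x, 0 ≤ h x)
    (x : Fin d → ℝ) :
    ENNReal.ofReal (convWith d g h x)
      ≤ ∫⁻ y, ENNReal.ofReal (g (x - y)) * ENNReal.ofReal (h y) := by
  refine (Real.ofReal_le_enorm _).trans ((enorm_integral_le_lintegral_enorm _).trans_eq ?_)
  refine lintegral_congr fun y => ?_
  rw [Real.enorm_of_nonneg (mul_nonneg (hg _) (hh _)), ENNReal.ofReal_mul (hg _)]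

/-- Integrating `ζ_k * h` over a cube, by Tonelli. -/
lemma setLIntegral_convWith_zetak_le (d : ℕ) {ε : ℝ} (hε : 0 < ε) {I : ℝ}
    (hI : ∫⁻ x : Fin d → ℝ, ENNReal.ofReal ((1 + ‖x‖) ^ (-(d + ε))) ≤ ENNReal.ofReal I)
    (hI0 : 0 ≤ I) {k : ℤ} {l : ℝ} (hl : 0 < l) (hk : (2:ℝ) ^ k ≤ l) (a : Fin d → ℝ)
    {h : (Fin d → ℝ) → ℝ} (hm : Measurable h) (hh : ∀ x, 0 ≤ h x) :
    ∫⁻ x in cube d a l, ENNReal.ofReal (convWith d (zetak d ε k) h x)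
      ≤ ENNReal.ofReal (I * 3 ^ (d + ε) + 4 ^ (d + ε)) *
        ∫⁻ y, ENNReal.ofReal (cubeWeight d (d + ε) a l y) * ENNReal.ofReal (h y) := by
  have hz := measurable_zetak d ε k
  calc ∫⁻ x in cube d a l, ENNReal.ofReal (convWith d (zetak d ε k) h x)
      ≤ ∫⁻ x in cube d a l, ∫⁻ y, ENNReal.ofReal (zetak d ε k (x - y)) * ENNReal.ofReal (h y) :=
        lintegral_mono fun x => ofReal_convWith_le (zetak_nonneg d ε k) hh x
    _ = ∫⁻ y, ∫⁻ x in cube d a l, ENNReal.ofReal (zetak d ε k (x - y)) * ENNReal.ofReal (h y) := by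
        refine lintegral_lintegral_swap (Measurable.aemeasurable ?_)
        exact (hz.comp (measurable_fst.sub measurable_snd)).ennreal_ofReal.mul
          (hm.comp measurable_snd).ennreal_ofReal
    _ ≤ ∫⁻ y, ENNReal.ofReal (I * 3 ^ (d + ε) + 4 ^ (d + ε)) *
          (ENNReal.ofReal (cubeWeight d (d + ε) a l y) * ENNReal.ofReal (h y)) := by
        refine lintegral_mono fun y => ?_
        have hzy : Measurable fun x => zetak d ε k (x - y) := hz.comp (measurable_id.sub_const y)
        rw [lintegral_mul_const _ hzy.ennreal_ofReal, ← mul_assoc,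
          ← ENNReal.ofReal_mul (by positivity)]
        gcongr
        exact setLIntegral_zetak_le d hε hI hI0 hl hk a y
    _ = _ := lintegral_const_mul _
        ((measurable_cubeWeight _ _ _ _).ennreal_ofReal.mul hm.ennreal_ofReal)

/-- A family of functions with uniformly bounded mass on the dyadic cubes of generation `j`
has bounded mass against a slowly varying weight. -/
lemma tsum_lintegral_cubeWeight_mul_le {κ : Type*} [Countable κ] {d : ℕ} {p : ℝ} (hp : 0 ≤ p)
    (a : Fin d → ℝ) {l : ℝ} (hl : 0 < l) {j : ℤ} (hj : (2:ℝ) ^ j ≤ 2 * l)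
    {g : κ → (Fin d → ℝ) → ℝ≥0∞} (hg : ∀ k, Measurable (g k)) {K : ℝ} (hK0 : 0 ≤ K)
    (hK : ∀ m, ∑' k, ∫⁻ y in dyadicCube d j m, g k y ≤ ENNReal.ofReal (2 ^ (j * (d:ℤ)) * K)) :
    ∑' k, ∫⁻ y, ENNReal.ofReal (cubeWeight d p a l y) * g k y
      ≤ ENNReal.ofReal (9 ^ p * K) * ∫⁻ y, ENNReal.ofReal (cubeWeight d p a l y) := by
  have hun : ∀ F : (Fin d → ℝ) → ℝ≥0∞, ∫⁻ y, F y = ∑' m, ∫⁻ y in dyadicCube d j m, F y := by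
    intro F
    rw [← lintegral_iUnion (measurableSet_dyadicCube d j) (pairwise_disjoint_dyadicCube d j),
      iUnion_dyadicCube, setLIntegral_univ]
  let c : (Fin d → ℤ) → (Fin d → ℝ) := fun m i => (2:ℝ) ^ j * m i
  have hc : ∀ m, ∀ y ∈ dyadicCube d j m, ‖y - c m‖ ≤ 2 * l := by
    intro m y hy
    rw [dyadicCube_eq_cube] at hy
    exact (norm_sub_le_of_mem_cube (by positivity) hy).trans hj
  have hWm := (measurable_cubeWeight d p a l).ennreal_ofReal
  have h1 : ∀ m k, ∫⁻ y in dyadicCube d j m, ENNReal.ofReal (cubeWeight d p a l y) * g k y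
      ≤ ENNReal.ofReal (3 ^ p * cubeWeight d p a l (c m)) * ∫⁻ y in dyadicCube d j m, g k y := by
    intro m k
    rw [← lintegral_const_mul _ (hg k)]
    refine setLIntegral_mono ((hg k).const_mul _) fun y hy => ?_
    gcongr
    exact cubeWeight_le_of_norm_sub_le hp a hl (hc m y hy)
  have h2 : ∀ m, ENNReal.ofReal (3 ^ p * cubeWeight d p a l (c m)) *
      ENNReal.ofReal (2 ^ (j * (d:ℤ)) * K)
      ≤ ENNReal.ofReal (9 ^ p * K) *
        ∫⁻ y in dyadicCube d j m, ENNReal.ofReal (cubeWeight d p a l y) := by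
    intro m
    rw [← lintegral_const_mul _ hWm]
    have e : ENNReal.ofReal (3 ^ p * cubeWeight d p a l (c m)) *
        ENNReal.ofReal (2 ^ (j * (d:ℤ)) * K)
        = ∫⁻ y in dyadicCube d j m, ENNReal.ofReal (3 ^ p * cubeWeight d p a l (c m) * K) := by
      have := cubeWeight_nonneg d p a hl (c m)
      rw [setLIntegral_const, volume_dyadicCube, ← ENNReal.ofReal_mul (by positivity),
        ← ENNReal.ofReal_mul (by positivity)]
      congr 1
      ring
    rw [e]
    refine setLIntegral_mono (hWm.const_mul _) fun y hy => ?_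
    rw [← ENNReal.ofReal_mul (by positivity)]
    refine ENNReal.ofReal_le_ofReal ?_
    have h3 : cubeWeight d p a l (c m) ≤ 3 ^ p * cubeWeight d p a l y :=
      cubeWeight_le_of_norm_sub_le hp a hl (by rw [norm_sub_rev]; exact hc m y hy)
    have h9 : (9:ℝ) ^ p = 3 ^ p * 3 ^ p := by
      rw [← Real.mul_rpow (by norm_num) (by norm_num)]; norm_num
    calc 3 ^ p * cubeWeight d p a l (c m) * K
        ≤ 3 ^ p * (3 ^ p * cubeWeight d p a l y) * K := by gcongr
      _ = 9 ^ p * K * cubeWeight d p a l y := by rw [h9]; ring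
  calc ∑' k, ∫⁻ y, ENNReal.ofReal (cubeWeight d p a l y) * g k y
      = ∑' m, ∑' k, ∫⁻ y in dyadicCube d j m, ENNReal.ofReal (cubeWeight d p a l y) * g k y := by
        rw [ENNReal.tsum_comm]
        exact tsum_congr fun k => hun _
    _ ≤ ∑' m, ENNReal.ofReal (9 ^ p * K) *
          ∫⁻ y in dyadicCube d j m, ENNReal.ofReal (cubeWeight d p a l y) := by
        refine ENNReal.tsum_le_tsum fun m => ?_
        refine (ENNReal.tsum_le_tsum fun k => h1 m k).trans ?_
        rw [ENNReal.tsum_mul_left]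
        exact (mul_le_mul_right (hK m) _).trans (h2 m)
    _ = _ := by rw [ENNReal.tsum_mul_left, ← hun]

/-- Uniform Carleson measure estimate, smoothed version: if `B` is a
`BMO` bound for `b`, then for every `n` and every cube `Q` (corner `a`, side `l`),
`Σ_{k : 2^k ≤ l} ∫_Q (ζ_k * |E_{k+1-n} b - E_{k-n} b|²)(x) dx ≤ C |Q| B²`, `C = C(d,ε)`. -/
theorem statement7 (d : ℕ) (hd : 1 ≤ d) (ε : ℝ) (hε : 0 < ε) :
    ∃ C : ℝ, 0 < C ∧ ∀ b : (Fin d → ℝ) → ℝ, LocallyIntegrable b volume →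
      ∀ B : ℝ,
      (∀ (a : Fin d → ℝ) (l : ℝ), 0 < l →
        ∫ x in cube d a l, |b x - (l ^ d)⁻¹ * ∫ y in cube d a l, b y| ≤ B * l ^ d) →
      ∀ (n : ℕ) (a : Fin d → ℝ) (l : ℝ), 0 < l →
        ∑' k : {k : ℤ // (2:ℝ) ^ k ≤ l},
            ∫⁻ x in cube d a l, ENNReal.ofReal
              (convWith d (zetak d ε k)
                (fun y => (dyadicCE d ((k:ℤ) + 1 - (n:ℤ)) b y - dyadicCE d ((k:ℤ) - (n:ℤ)) b y) ^ 2) x)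
          ≤ ENNReal.ofReal (C * l ^ d * B ^ 2) := by
  have hfin : ∫⁻ x : Fin d → ℝ, ENNReal.ofReal ((1 + ‖x‖) ^ (-(d + ε))) < ∞ :=
    finite_integral_one_add_norm (by rw [Module.finrank_fin_fun]; linarith)
  set I : ℝ := (∫⁻ x : Fin d → ℝ, ENNReal.ofReal ((1 + ‖x‖) ^ (-(d + ε)))).toReal with hIdef
  have hI0 : 0 ≤ I := ENNReal.toReal_nonneg
  have hI : ∫⁻ x : Fin d → ℝ, ENNReal.ofReal ((1 + ‖x‖) ^ (-(d + ε))) = ENNReal.ofReal I :=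
    (ENNReal.ofReal_toReal hfin.ne).symm
  set p : ℝ := d + ε with hpdef
  have hp : 0 < p := by positivity
  refine ⟨(I * 3 ^ p + 4 ^ p) * (9 ^ p * (2 * (2 + 2 ^ d) ^ 2)) * I + 1, by positivity, ?_⟩
  intro b hb B hB n a l hl
  obtain ⟨j, hj1, hj2⟩ := exists_mem_Ico_zpow hl one_lt_two
  let g : {k : ℤ // (2:ℝ) ^ k ≤ l} → (Fin d → ℝ) → ℝ := fun k y =>
    (dyadicCE d ((k:ℤ) + 1 - (n:ℤ)) b y - dyadicCE d ((k:ℤ) - (n:ℤ)) b y) ^ 2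
  have hg : ∀ k, Measurable (g k) := fun k =>
    ((measurable_dyadicCE d _ b).sub (measurable_dyadicCE d _ b)).pow_const 2
  have hkj : ∀ k : {k : ℤ // (2:ℝ) ^ k ≤ l}, (k:ℤ) ≤ j := fun k =>
    Int.lt_add_one_iff.1 ((zpow_lt_zpow_iff_right₀ one_lt_two).1 (k.2.trans_lt hj2))
  have hj : (2:ℝ) ^ (j + 1) ≤ 2 * l := by
    rw [zpow_add₀ two_ne_zero, zpow_one]; linarith
  have hK : ∀ m, ∑' k, ∫⁻ y in dyadicCube d (j + 1) m, ENNReal.ofReal (g k y)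
      ≤ ENNReal.ofReal (2 ^ ((j + 1) * (d:ℤ)) * (2 * (2 + 2 ^ d) ^ 2 * B ^ 2)) := by
    intro m
    refine le_trans ?_ (tsum_lintegral_dyadicCE_sub_sq_le hb hB (j + 1) m)
    have hinj : Function.Injective
        fun k : {k : ℤ // (2:ℝ) ^ k ≤ l} => (j - (k:ℤ) + n).toNat := by
      intro k k' h
      have h1 := hkj k
      have h2 := hkj k'
      simp only at h
      exact Subtype.ext (by omega)
    refine le_trans (le_of_eq (tsum_congr fun k => ?_))
      (ENNReal.tsum_comp_le_tsum_of_injective hinj _)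
    have h1 := hkj k
    have e : (j + 1) - (((j - (k:ℤ) + n).toNat : ℕ) : ℤ) = (k:ℤ) + 1 - n := by omega
    simp only [g, e]
    rw [show (k:ℤ) + 1 - n - 1 = k - n by ring]
  calc _ ≤ ∑' k, ENNReal.ofReal (I * 3 ^ p + 4 ^ p) *
        ∫⁻ y, ENNReal.ofReal (cubeWeight d p a l y) * ENNReal.ofReal (g k y) :=
        ENNReal.tsum_le_tsum fun k => setLIntegral_convWith_zetak_le d hε hI.le hI0 hl k.2 a
          (hg k) fun x => sq_nonneg _
    _ ≤ ENNReal.ofReal (I * 3 ^ p + 4 ^ p) * (ENNReal.ofReal (9 ^ p * (2 * (2 + 2 ^ d) ^ 2 * B ^ 2))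
        * ∫⁻ y, ENNReal.ofReal (cubeWeight d p a l y)) := by
        rw [ENNReal.tsum_mul_left]
        gcongr
        exact tsum_lintegral_cubeWeight_mul_le hp.le a hl hj (fun k => (hg k).ennreal_ofReal)
          (by positivity) hK
    _ = ENNReal.ofReal ((I * 3 ^ p + 4 ^ p) *
        (9 ^ p * (2 * (2 + 2 ^ d) ^ 2 * B ^ 2) * (l ^ d * I))) := by
        rw [lintegral_cubeWeight _ _ _ hl, hI, ← ENNReal.ofReal_mul (by positivity),
          ← ENNReal.ofReal_mul (by positivity), ← ENNReal.ofReal_mul (by positivity)]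
    _ ≤ _ := by
        refine ENNReal.ofReal_le_ofReal ?_
        have : 0 ≤ l ^ d * B ^ 2 := by positivity
        linarith
end
end

section
/- Let N ≥ 1 and let K ⊂ ℝ^N be a bounded convex set contained in the closed ball of radius t > 0 centered at the origin. Then there exists a constant C = C(N), depending only on the dimension N, such that for every vector v ∈ ℝ^N the Lebesgue measure of the symmetric difference (v + K) Δ K satisfies |(v + K) Δ K| ≤ C |v| t^{N−1}. -/
open MeasureTheory
open scoped ENNReal

section ConvexTranslate

variable {E : Type*} [NormedAddCommGroup E] [NormedSpace ℝ E]

/-- Successive translates by `v` of the part of a convex set lost under translation by `v` are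
pairwise disjoint. -/
lemma Convex.pairwise_disjoint_preimage_sub_natCast_smul {K : Set E} (hK : Convex ℝ K) (v : E) :
    Pairwise (Function.onFun Disjoint
      fun j : ℕ => (fun x => x - (j : ℝ) • v) ⁻¹' (K \ (fun x => x - v) ⁻¹' K)) := by
  rw [pairwise_disjoint_on]
  intro i j hij
  rw [Set.disjoint_left]
  rintro x ⟨hi, hi'⟩ ⟨hj, -⟩
  apply hi'
  have hd : (1 : ℝ) ≤ (j : ℝ) - i := by
    have : (i : ℝ) + 1 ≤ j := by exact_mod_cast hij
    linarith
  have hd0 : (0 : ℝ) < (j : ℝ) - i := by linarith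
  have hmem := hK hi hj (a := 1 - ((j : ℝ) - i)⁻¹) (b := ((j : ℝ) - i)⁻¹)
    (sub_nonneg.2 (inv_le_one_of_one_le₀ hd)) (inv_nonneg.2 hd0.le) (by ring)
  have hc : ((j : ℝ) - i)⁻¹ * ((j : ℝ) - i) = 1 := inv_mul_cancel₀ hd0.ne'
  have key : (1 - ((j : ℝ) - i)⁻¹) • (x - (i : ℝ) • v) + ((j : ℝ) - i)⁻¹ • (x - (j : ℝ) • v)
      = x - (i : ℝ) • v - (((j : ℝ) - i)⁻¹ * ((j : ℝ) - i)) • v := by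
    module
  rw [key, hc, one_smul] at hmem
  exact hmem

variable [FiniteDimensional ℝ E] [MeasurableSpace E] [BorelSpace E]

/-- The part of a convex subset of a ball of radius `t` lost under translation by `v` has measure
`O(‖v‖ * t ^ (d - 1))`, where `d` is the dimension. -/
lemma Convex.measure_sdiff_preimage_sub_le (μ : Measure E) [μ.IsAddHaarMeasure] {K : Set E}
    (hK : Convex ℝ K) {t : ℝ} (ht : 0 < t) (hKt : K ⊆ Metric.closedBall 0 t)
    (hE : 1 ≤ Module.finrank ℝ E) (v : E) :
    μ (K \ (fun x => x - v) ⁻¹' K) ≤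
      ENNReal.ofReal (2 ^ Module.finrank ℝ E * μ.real (Metric.ball 0 1) * ‖v‖ *
        t ^ (Module.finrank ℝ E - 1)) := by
  rcases eq_or_ne v 0 with rfl | hv
  · simp
  have hv0 : 0 < ‖v‖ := norm_pos_iff.2 hv
  set d := Module.finrank ℝ E with hd
  set A := K \ (fun x => x - v) ⁻¹' K
  set n := ⌊t / ‖v‖⌋₊
  have hAm : NullMeasurableSet A μ := by
    have hKm := hK.nullMeasurableSet (μ := μ)
    exact hKm.diff (hKm.preimage (measurePreserving_sub_right μ v).quasiMeasurePreserving)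
  have hnv : n * ‖v‖ ≤ t := (le_div_iff₀ hv0).1 (Nat.floor_le (by positivity))
  have htn : t ≤ (n + 1) * ‖v‖ := ((div_lt_iff₀ hv0).1 (Nat.lt_floor_add_one _)).le
  have hsub : (⋃ j ∈ Finset.range (n + 1), (fun x => x - (j : ℝ) • v) ⁻¹' A) ⊆
      Metric.closedBall 0 (2 * t) := by
    simp only [Set.iUnion_subset_iff, Finset.mem_range]
    intro j hj x hx
    have h1 : ‖x - (j : ℝ) • v‖ ≤ t := by simpa using hKt hx.1
    have h2 : ‖(j : ℝ) • v‖ ≤ t := by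
      rw [norm_smul, Real.norm_natCast]
      have : (j : ℝ) ≤ n := by exact_mod_cast Nat.lt_succ_iff.1 hj
      exact (mul_le_mul_of_nonneg_right this hv0.le).trans hnv
    have h3 := norm_add_le (x - (j : ℝ) • v) ((j : ℝ) • v)
    rw [sub_add_cancel] at h3
    rw [mem_closedBall_zero_iff]
    linarith
  have hcard : ((n + 1 : ℕ) : ℝ≥0∞) * μ A ≤ μ (Metric.closedBall 0 (2 * t)) := by
    refine le_trans (le_of_eq ?_) (measure_mono hsub)
    rw [measure_biUnion_finset₀]
    · simp [fun j : ℕ => (measurePreserving_sub_right μ ((j : ℝ) • v)).measure_preimage hAm]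
    · exact fun i _ j _ hij => (hK.pairwise_disjoint_preimage_sub_natCast_smul v hij).aedisjoint
    · exact fun j _ => hAm.preimage (measurePreserving_sub_right μ _).quasiMeasurePreserving
  rw [μ.addHaar_closedBall 0 (by positivity), ← hd] at hcard
  have hAfin : μ A ≠ ∞ :=
    measure_ne_top_of_subset (Set.sdiff_subset.trans hKt) measure_closedBall_lt_top.ne
  rw [ENNReal.le_ofReal_iff_toReal_le hAfin (by positivity)]
  have hreal := ENNReal.toReal_mono (by finiteness) hcard
  rw [ENNReal.toReal_mul, ENNReal.toReal_mul, ENNReal.toReal_natCast,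
    ENNReal.toReal_ofReal (by positivity)] at hreal
  change _ ≤ (2 * t) ^ d * μ.real (Metric.ball 0 1) at hreal
  push_cast at hreal
  obtain ⟨m, hm⟩ : ∃ m, d = m + 1 := ⟨d - 1, by omega⟩
  rw [hm] at hreal ⊢
  rw [Nat.add_sub_cancel]
  have hA0 : 0 ≤ (μ A).toReal := ENNReal.toReal_nonneg
  refine le_of_mul_le_mul_left ?_ ht
  calc t * (μ A).toReal ≤ ((n + 1) * ‖v‖) * (μ A).toReal := by gcongr
    _ = ‖v‖ * ((n + 1) * (μ A).toReal) := by ring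
    _ ≤ ‖v‖ * ((2 * t) ^ (m + 1) * μ.real (Metric.ball 0 1)) := by gcongr
    _ = _ := by ring

end ConvexTranslate

/-- For a bounded convex set `K ⊆ ℝ^N` contained in the closed ball of
radius `t > 0` about the origin, the translate `v + K` satisfies
`|(v + K) Δ K| ≤ C |v| t^{N-1}` with `C = C(N)` depending only on the dimension. -/
theorem statement9 (N : ℕ) (hN : 1 ≤ N) :
    ∃ C : ℝ, 0 < C ∧ ∀ (K : Set (EuclideanSpace ℝ (Fin N))) (t : ℝ), 0 < t →
      Convex ℝ K → Bornology.IsBounded K → K ⊆ Metric.closedBall 0 t →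
      ∀ v : EuclideanSpace ℝ (Fin N),
        volume (symmDiff ((fun z => v + z) '' K) K) ≤ ENNReal.ofReal (C * ‖v‖ * t ^ (N - 1)) := by
  have hω : 0 < (volume : Measure (EuclideanSpace ℝ (Fin N))).real (Metric.ball 0 1) :=
    ENNReal.toReal_pos (Metric.measure_ball_pos _ _ one_pos).ne' measure_ball_lt_top.ne
  refine ⟨2 * (2 ^ N * (volume : Measure (EuclideanSpace ℝ (Fin N))).real (Metric.ball 0 1)),
    by positivity, fun K t ht hK _ hKt v => ?_⟩
  have himage : (fun z => v + z) '' K = (fun x => x - v) ⁻¹' K := by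
    rw [Set.image_add_left]
    ext x
    simp [sub_eq_neg_add]
  have hbound := fun w => hK.measure_sdiff_preimage_sub_le volume ht hKt (by simpa using hN) w
  simp only [finrank_euclideanSpace, Fintype.card_fin] at hbound
  have hK' := hK.nullMeasurableSet (μ := volume)
  have hshift : volume ((fun x => x - v) ⁻¹' K \ K) = volume (K \ (fun x => x - -v) ⁻¹' K) := by
    rw [← (measurePreserving_sub_right volume v).measure_preimage
      (hK'.diff (hK'.preimage (measurePreserving_sub_right volume (-v)).quasiMeasurePreserving))]
    congr 1
    ext x
    simp
  rw [himage, Set.symmDiff_def]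
  refine (measure_union_le _ _).trans ?_
  rw [hshift]
  refine (add_le_add (hbound (-v)) (hbound v)).trans ?_
  rw [norm_neg, ← ENNReal.ofReal_add (by positivity) (by positivity)]
  apply le_of_eq
  congr 1
  ring
end

section
/- Let d ≥ 1, n ∈ ℤ, and let h be a real-valued (n−1)-measurable function on ℝ^d, i.e., constant on each dyadic cube of side 2^{n−1}. Then the maximal function h* satisfies ∫_{ℝ^d} (h*(x))² dx ≤ 3^d ∫_{ℝ^d} h(x)² dx. -/
open MeasureTheory
open scoped ENNReal

noncomputable section

/-- `h` is constant on every dyadic cube of generation `j` (side `2^j`). -/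
def DyadicConst (d : ℕ) (j : ℤ) (h : (Fin d → ℝ) → ℝ) : Prop :=
  ∀ x y : Fin d → ℝ, (∀ i, ⌊(2:ℝ) ^ (-j) * x i⌋ = ⌊(2:ℝ) ^ (-j) * y i⌋) → h x = h y

/-- For an `(n-1)`-measurable function `h`, `dstar d n h x` is the maximum of `|h|` over
the dyadic cube of side `2^{n-1}` containing `x` together with its neighbouring cubes
(i.e. those contained in the concentric triple). -/
def dstar (d : ℕ) (n : ℤ) (h : (Fin d → ℝ) → ℝ) (x : Fin d → ℝ) : ℝ :=
  ⨆ e : Fin d → Fin 3, |h (fun i => x i + (2:ℝ) ^ (n - 1) * (((e i : ℕ) : ℝ) - 1))|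

/-- A function that is constant on dyadic cubes is measurable: it factors through the
countable set of cubes. -/
theorem DyadicConst.measurable {d : ℕ} {j : ℤ} {h : (Fin d → ℝ) → ℝ} (H : DyadicConst d j h) :
    Measurable h := by
  let cube : (Fin d → ℝ) → Fin d → ℤ := fun x i => ⌊(2:ℝ) ^ (-j) * x i⌋
  have hcube : Measurable cube :=
    measurable_pi_lambda _ fun i => ((measurable_pi_apply i).const_mul _).floor
  have hfactor : h.FactorsThrough cube := fun x y hxy => H x y fun i => congrFun hxy i
  rw [← hfactor.extend_comp (fun _ => 0)]
  exact (measurable_of_countable _).comp hcube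

/-- The square of the maximal function is bounded by the sum of the squares of the translates. -/
theorem dstar_sq_le_sum (d : ℕ) (n : ℤ) (h : (Fin d → ℝ) → ℝ) (x : Fin d → ℝ) :
    ENNReal.ofReal (dstar d n h x ^ 2) ≤ ∑ e : Fin d → Fin 3,
      ENNReal.ofReal (h (x + fun i => (2:ℝ) ^ (n - 1) * (((e i : ℕ) : ℝ) - 1)) ^ 2) := by
  obtain ⟨e, he⟩ := exists_eq_ciSup_of_finite (f := fun e : Fin d → Fin 3 =>
    |h (fun i => x i + (2:ℝ) ^ (n - 1) * (((e i : ℕ) : ℝ) - 1))|)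
  rw [dstar, ← he, sq_abs]
  exact Finset.single_le_sum (f := fun e : Fin d → Fin 3 =>
    ENNReal.ofReal (h (x + fun i => (2:ℝ) ^ (n - 1) * (((e i : ℕ) : ℝ) - 1)) ^ 2))
    (fun _ _ => zero_le) (Finset.mem_univ e)

/-- For an `(n-1)`-measurable function `h` on `ℝ^d`,
`∫ (h*)² ≤ 3^d ∫ h²`. -/
theorem statement11 (d : ℕ) (hd : 1 ≤ d) (n : ℤ)
    (h : (Fin d → ℝ) → ℝ) (H : DyadicConst d (n - 1) h) :
    ∫⁻ x, ENNReal.ofReal (dstar d n h x ^ 2)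
      ≤ (3 : ℝ≥0∞) ^ d * ∫⁻ x, ENNReal.ofReal (h x ^ 2) := by
  have hm : Measurable fun x => ENNReal.ofReal (h x ^ 2) :=
    (H.measurable.pow_const 2).ennreal_ofReal
  refine (lintegral_mono (dstar_sq_le_sum d n h)).trans_eq ?_
  rw [lintegral_finsetSum]
  swap
  · exact fun e _ => hm.comp (measurable_add_const _)
  simp [lintegral_add_right_eq_self (fun x => ENNReal.ofReal (h x ^ 2))]
end
end
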